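/- Let k be a field of characteristic p. In the SL₂(F_p)-representation Sym^r(k²) with 0 ≤ r ≤ p-1, let e be a nonzero vector fixed by the upper unipotent subgroup Ū, let ν = (1 1; 0 1), n_s = (0 1; -1 0), and t = [ν] - 1 ∈ k[SL₂(F_p)]. Then t^r n_s⁻¹ e = r! · e. -/

import Mathlib

/-- The substitution action of a `2×2` matrix over `F_p` on polynomials in two variables
over a ring `k` of characteristic `p`: `X i ↦ ∑ j, g i j • X j`. -/
noncomputable def matAct (p : ℕ) (k : Type*) [CommRing k] [CharP k p]
    (g : Matrix (Fin 2) (Fin 2) (ZMod p)) :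
    MvPolynomial (Fin 2) k →ₐ[k] MvPolynomial (Fin 2) k :=
  MvPolynomial.aeval fun i =>
    ∑ j, MvPolynomial.C (ZMod.castHom (dvd_refl p) k (g i j)) * MvPolynomial.X j

open MvPolynomial in
lemma matAct_eval {p : ℕ} [Fact p.Prime] {k : Type*} [Field k] [CharP k p] (a : ZMod p)
    (e : MvPolynomial (Fin 2) k) :
    aeval ![(0 : k), 1] (matAct p k (!![1, a; 0, 1] : Matrix (Fin 2) (Fin 2) (ZMod p)) e)
      = aeval ![ZMod.castHom (dvd_refl p) k a, 1] e := by
  rw [matAct, ← AlgHom.comp_apply]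
  congr 1
  ext i
  fin_cases i <;> simp

open MvPolynomial in
lemma fixed_form (p : ℕ) [Fact p.Prime] (k : Type*) [Field k] [CharP k p]
    (r : ℕ) (hr : r ≤ p - 1)
    (e : MvPolynomial (Fin 2) k) (hhom : e.IsHomogeneous r)
    (hfix : ∀ a : ZMod p,
      matAct p k (!![1, a; 0, 1] : Matrix (Fin 2) (Fin 2) (ZMod p)) e = e) :
    ∃ c : k, e = C c * X 1 ^ r := by
  have hp : 0 < p := (Fact.out : p.Prime).pos
  set f : Polynomial k := aeval ![Polynomial.X, 1] e with hf
  have hev : ∀ x : k, f.eval x = aeval ![x, 1] e := by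
    intro x
    rw [hf, ← Polynomial.coe_aeval_eq_eval]
    change (Polynomial.aeval x) _ = _
    rw [← AlgHom.comp_apply]
    congr 1
    ext i
    fin_cases i <;> simp
  have hdeg : f.natDegree ≤ r * 1 := by
    refine aeval_natDegree_le e hhom.totalDegree_le _ ?_
    intro i
    fin_cases i <;> simp
  have hconst : f - Polynomial.C (f.eval 0) = 0 := by
    refine Polynomial.eq_zero_of_natDegree_lt_card_of_eval_eq_zero _
      (f := ZMod.castHom (dvd_refl p) k) (RingHom.injective _) ?_ ?_
    · intro a
      rw [Polynomial.eval_sub, Polynomial.eval_C, hev, hev, ← matAct_eval, hfix, sub_self]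
    · rw [Polynomial.natDegree_sub_C, ZMod.card]
      omega
  refine ⟨f.eval 0, ?_⟩
  rw [← Polynomial.homogenize_C, ← sub_eq_zero.mp hconst]
  exact (Polynomial.homogenize_eq_of_isHomogeneous hhom hf.symm).symm

open MvPolynomial in
lemma diff_pow (p : ℕ) [Fact p.Prime] (k : Type*) [Field k] [CharP k p]
    (n : ℕ) : ∀ m ≤ n, ∀ j : ℕ, ∀ c : k,
    ((((matAct p k (!![1, 1; 0, 1] : Matrix (Fin 2) (Fin 2) (ZMod p))).toLinearMap
        - LinearMap.id : Module.End k (MvPolynomial (Fin 2) k)) ^ n)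
      (C c * X 0 ^ m * X 1 ^ j)) = if m = n then C (c * n.factorial) * X 1 ^ (n + j) else 0 := by
  induction n with
  | zero =>
    intro m hm j c
    obtain rfl : m = 0 := by omega
    simp
  | succ n ih =>
    intro m hm j c
    have key : ((matAct p k (!![1, 1; 0, 1] : Matrix (Fin 2) (Fin 2) (ZMod p))).toLinearMap
        - LinearMap.id : Module.End k (MvPolynomial (Fin 2) k)) (C c * X 0 ^ m * X 1 ^ j)
        = ∑ l ∈ Finset.range m, C (c * (m.choose l : k)) * X 0 ^ l * X 1 ^ (m - l + j) := by
      have h1 : matAct p k (!![1, 1; 0, 1] : Matrix (Fin 2) (Fin 2) (ZMod p))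
          (C c * X 0 ^ m * X 1 ^ j) = C c * (X 0 + X 1) ^ m * X 1 ^ j := by
        simp [matAct, algebraMap_eq]
      simp only [LinearMap.sub_apply, AlgHom.toLinearMap_apply, LinearMap.id_apply]
      rw [h1, add_pow, Finset.sum_range_succ, mul_add, add_mul, Finset.mul_sum, Finset.sum_mul]
      simp only [Nat.sub_self, pow_zero, mul_one, Nat.choose_self, Nat.cast_one, add_sub_cancel_right]
      refine Finset.sum_congr rfl fun l _ => ?_
      rw [C_mul, map_natCast, pow_add]
      ring
    rw [pow_succ, Module.End.mul_apply, key, map_sum]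
    rw [Finset.sum_congr (s₁ := Finset.range m) rfl fun l hl => ih l (by revert hl; intro hl; have := Finset.mem_range.mp hl; omega) _ _]
    rw [Finset.sum_ite_eq' (Finset.range m) n]
    by_cases h : m = n + 1
    · subst h
      simp only [Finset.mem_range, lt_add_iff_pos_right, Nat.lt_one_iff, if_true, zero_lt_one]
      rw [Nat.choose_succ_self_right, Nat.factorial_succ, show n + (n + 1 - n + j) = n + 1 + j by omega,
        mul_assoc, Nat.cast_mul]
    · rw [if_neg h, if_neg (by simp; omega)]

/-- In `Sym^r(k²)` (homogeneous polynomials of degree `r ≤ p-1` in two variables), if `e`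
is a nonzero vector fixed by the upper unipotent subgroup, then
`t^r n_s⁻¹ e = r! e`, where `t = [ν] - 1` with `ν = (1 1; 0 1)` and `n_s⁻¹ = (0 -1; 1 0)`. -/
theorem stmt4 (p : ℕ) [Fact p.Prime] (k : Type*) [Field k] [CharP k p]
    (r : ℕ) (hr : r ≤ p - 1)
    (e : MvPolynomial (Fin 2) k) (he : e ≠ 0)
    (hhom : e ∈ MvPolynomial.homogeneousSubmodule (Fin 2) k r)
    (hfix : ∀ a : ZMod p,
      matAct p k (!![1, a; 0, 1] : Matrix (Fin 2) (Fin 2) (ZMod p)) e = e) :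
    ((((matAct p k (!![1, 1; 0, 1] : Matrix (Fin 2) (Fin 2) (ZMod p))).toLinearMap
        - LinearMap.id : Module.End k (MvPolynomial (Fin 2) k)) ^ r)
      ((matAct p k (!![0, -1; 1, 0] : Matrix (Fin 2) (Fin 2) (ZMod p))) e))
      = (r.factorial : k) • e := by
  obtain ⟨c, rfl⟩ := fixed_form p k r hr e hhom hfix
  have h1 : matAct p k (!![0, -1; 1, 0] : Matrix (Fin 2) (Fin 2) (ZMod p))
      (MvPolynomial.C c * MvPolynomial.X 1 ^ r)
      = MvPolynomial.C c * MvPolynomial.X 0 ^ r * MvPolynomial.X 1 ^ 0 := by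
    simp [matAct, MvPolynomial.algebraMap_eq]
  rw [h1, diff_pow p k r r le_rfl, if_pos rfl, MvPolynomial.smul_eq_C_mul, MvPolynomial.C_mul,
    add_zero]
  ring
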